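/- arXiv:1811.04218 — 2 statements merged into one kernel-verified Lean document; each statement's English description precedes it below -/
import Mathlib

section
/- Let α ∈ (1,∞). Then the Petz Rényi information satisfies I^{(1)}_α(P,W) ≤ log(#{i : P(i) > 0}), i.e., the order-α Rényi information of any prior P is bounded above by the logarithm of the cardinality of the support of P. -/
open Matrix
open scoped ComplexOrder

/-- Real power of a (hermitian) matrix via the continuous functional calculus. -/
noncomputable def mpow {ι : Type*} [Fintype ι] [DecidableEq ι]
    (A : Matrix ι ι ℂ) (r : ℝ) : Matrix ι ι ℂ :=
  cfc (fun x : ℝ => x ^ r) A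

/-- Logarithm of a (hermitian) matrix via the continuous functional calculus. -/
noncomputable def mlog {ι : Type*} [Fintype ι] [DecidableEq ι]
    (A : Matrix ι ι ℂ) : Matrix ι ι ℂ :=
  cfc Real.log A

/-- Real part of the trace. -/
noncomputable def trR {ι : Type*} [Fintype ι] (A : Matrix ι ι ℂ) : ℝ :=
  (Matrix.trace A).re

/-- Positive definite density matrices. -/
def Dens (d : ℕ) : Type :=
  {σ : Matrix (Fin d) (Fin d) ℂ // σ.PosDef ∧ σ.trace = 1}

/-- Petz Rényi information of order `α ≠ 1`. -/
noncomputable def renyiInfo {d n : ℕ} (α : ℝ) (W : Fin n → Matrix (Fin d) (Fin d) ℂ)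
    (P : Fin n → ℝ) : ℝ :=
  ⨅ σ : Dens d, (1 / (α - 1)) *
    Real.log (∑ i, P i * trR (mpow (W i) α * mpow σ.1 (1 - α)))

section MatrixPower

open scoped MatrixOrder Matrix.Norms.L2Operator

variable {ι : Type*} [Fintype ι] {A B : Matrix ι ι ℂ}

lemma trR_sum {κ : Type*} (s : Finset κ) (M : κ → Matrix ι ι ℂ) :
    trR (∑ i ∈ s, M i) = ∑ i ∈ s, trR (M i) := by
  simp [trR, Matrix.trace_sum]

lemma trR_smul (c : ℝ) (M : Matrix ι ι ℂ) : trR (c • M) = c * trR M := by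
  simp [trR, Matrix.trace_smul]

lemma trR_pos [Nonempty ι] (hA : A.PosDef) : 0 < trR A := by
  simpa [trR] using (Complex.lt_def.mp hA.trace_pos).1

variable [DecidableEq ι]

lemma mpow_eq_rpow (hA : A.PosDef) (r : ℝ) : mpow A r = A ^ r :=
  (CFC.rpow_eq_cfc_real hA.posSemidef.nonneg).symm

lemma mpow_posDef (hA : A.PosDef) (r : ℝ) : (mpow A r).PosDef := by
  rw [mpow_eq_rpow hA]
  exact (IsStrictlyPositive.rpow A r hA.isStrictlyPositive).posDef

lemma mpow_one (hA : A.PosDef) : mpow A 1 = A := by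
  rw [mpow_eq_rpow hA, CFC.rpow_one A hA.posSemidef.nonneg]

lemma mpow_mul_mpow (hA : A.PosDef) (r s : ℝ) : mpow A r * mpow A s = mpow A (r + s) := by
  simp only [mpow_eq_rpow hA, CFC.rpow_add hA.isUnit]

lemma mpow_mpow (hA : A.PosDef) {r : ℝ} (hr : r ≠ 0) (s : ℝ) :
    mpow (mpow A r) s = mpow A (r * s) := by
  rw [mpow_eq_rpow (mpow_posDef hA r), mpow_eq_rpow hA, mpow_eq_rpow hA,
    CFC.rpow_rpow A r s hr hA.isStrictlyPositive]

lemma mpow_smul (hA : A.PosDef) {c : ℝ} (hc : 0 < c) (r : ℝ) :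
    mpow (c • A) r = c ^ r • mpow A r := by
  have hsa : IsSelfAdjoint A := hA.1
  have hfin : ∀ M : Matrix ι ι ℂ, ∀ f : ℝ → ℝ, ContinuousOn f (spectrum ℝ M) :=
    fun M f => M.finite_real_spectrum.continuousOn f
  have himage : ContinuousOn (fun x : ℝ => x ^ r) (Set.image (c * ·) (spectrum ℝ A)) :=
    (A.finite_real_spectrum.image _).continuousOn _
  unfold mpow
  rw [← cfc_comp_const_mul c _ A himage hsa, ← cfc_smul _ _ A (hfin A _)]
  refine cfc_congr fun x hx => ?_
  have hx0 : 0 ≤ x := spectrum_nonneg_of_nonneg hA.posSemidef.nonneg hx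
  simp [Real.mul_rpow hc.le hx0]

/-- The function `x ↦ x ^ r` is operator antitone for `r ∈ [-1, 0]`. -/
lemma mpow_le_mpow_of_exponent_nonpos (hA : A.PosDef) (hB : B.PosDef) (hAB : A ≤ B) {r : ℝ}
    (hr : -1 ≤ r) (hr0 : r ≤ 0) : mpow B r ≤ mpow A r := by
  rw [mpow_eq_rpow hA, mpow_eq_rpow hB]
  rcases hr0.eq_or_lt with rfl | hr0
  · rw [CFC.rpow_zero A hA.posSemidef.nonneg, CFC.rpow_zero B hB.posSemidef.nonneg]
  have h : ∀ {M : Matrix ι ι ℂ}, M.PosDef → M ^ r = Ring.inverse (M ^ (-r)) := fun hM => by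
    rw [CFC.inverse_rpow _ _ (by linarith) hM.isStrictlyPositive, neg_neg]
  rw [h hA, h hB]
  exact CStarAlgebra.antitoneOn_ringInverse
    (IsStrictlyPositive.rpow A _ hA.isStrictlyPositive)
    (IsStrictlyPositive.rpow B _ hB.isStrictlyPositive)
    (CFC.rpow_le_rpow ⟨by linarith, by linarith⟩ hAB)

lemma trR_mul_le_trR_mul {C : Matrix ι ι ℂ} (hC : C.PosSemidef) (hAB : A ≤ B) :
    trR (C * A) ≤ trR (C * B) := by
  obtain ⟨D, rfl⟩ := CStarAlgebra.nonneg_iff_eq_star_mul_self.mp hC.nonneg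
  have h := ((Matrix.le_iff.mp hAB).mul_mul_conjTranspose_same D).trace_nonneg
  have h' : trR (star D * D * B) - trR (star D * D * A) = ((D * (B - A) * Dᴴ).trace).re := by
    rw [Matrix.trace_mul_cycle, Matrix.mul_sub, Matrix.trace_sub, Complex.sub_re]
    rfl
  have := (Complex.le_def.mp h).1
  simp only [Complex.zero_re] at this
  linarith

/-- The Rotfeld inequality for powers: `A ↦ Tr (A ^ p)` is subadditive for `p ∈ [0, 1]`. -/
lemma trR_mpow_sum_le {κ : Type*} {s : Finset κ} (hs : s.Nonempty) {M : κ → Matrix ι ι ℂ}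
    (hM : ∀ i ∈ s, (M i).PosDef) {p : ℝ} (hp0 : 0 ≤ p) (hp1 : p ≤ 1) :
    trR (mpow (∑ i ∈ s, M i) p) ≤ ∑ i ∈ s, trR (mpow (M i) p) := by
  have hS := Matrix.posDef_sum hs hM
  have hsplit : ∀ {N : Matrix ι ι ℂ}, N.PosDef → mpow N p = N * mpow N (p - 1) := fun hN => by
    conv_rhs => rw [← mpow_one hN, mpow_mpow hN one_ne_zero, one_mul, mpow_mul_mpow hN]
    ring_nf
  rw [hsplit hS, Finset.sum_mul, trR_sum]
  refine Finset.sum_le_sum fun i hi => ?_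
  rw [hsplit (hM i hi)]
  exact trR_mul_le_trR_mul (hM i hi).posSemidef <|
    mpow_le_mpow_of_exponent_nonpos (hM i hi) hS
      (Finset.single_le_sum (fun j hj => (hM j hj).posSemidef.nonneg) hi)
      (by linarith) (by linarith)

/-- The normalized power `S ^ (1 / α) / Tr (S ^ (1 / α))` turns `Tr (S σ ^ (1 - α))` into
`(Tr (S ^ (1 / α))) ^ α`. -/
lemma trR_mul_mpow_normalized [Nonempty ι] (hA : A.PosDef) {α : ℝ} (hα : 0 < α) :
    trR (A * mpow ((trR (mpow A (1 / α)))⁻¹ • mpow A (1 / α)) (1 - α)) =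
      trR (mpow A (1 / α)) ^ α := by
  have hT := mpow_posDef hA (1 / α)
  have ht := trR_pos hT
  rw [mpow_smul hT (inv_pos.mpr ht), mpow_mpow hA (by positivity), Matrix.mul_smul, trR_smul]
  have h : A * mpow A (1 / α * (1 - α)) = mpow A (1 / α) := by
    conv_lhs => rw [← mpow_one hA, mpow_mpow hA one_ne_zero, one_mul, mpow_mul_mpow hA]
    congr 1
    field_simp
    ring
  rw [h, Real.inv_rpow ht.le, ← Real.rpow_neg ht.le, neg_sub, Real.rpow_sub_one ht.ne']
  field_simp

end MatrixPower

/-- for `α ∈ (1,∞)`, the Petz Rényi information is bounded by the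
logarithm of the cardinality of the support of the prior. -/
theorem renyiInfo_le_log_card_support {d n : ℕ} (hd : 0 < d) (hn : 0 < n)
    (W : Fin n → Matrix (Fin d) (Fin d) ℂ)
    (hW : ∀ i, (W i).PosDef ∧ (W i).trace = 1)
    (P : Fin n → ℝ) (hP : ∀ i, 0 ≤ P i) (hP1 : ∑ i, P i = 1)
    (α : ℝ) (hα : 1 < α) :
    renyiInfo α W P ≤
      Real.log ((Finset.univ.filter (fun i => 0 < P i)).card : ℝ) := by
  have : Nonempty (Fin d) := ⟨⟨0, hd⟩⟩
  have hα0 : 0 < α := by linarith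
  set s := Finset.univ.filter (fun i => 0 < P i) with hs_def
  have hsupp : ∀ i, i ∉ s → P i = 0 := fun i hi =>
    le_antisymm (not_lt.mp fun h => hi (by simp [hs_def, h])) (hP i)
  have hsP : ∀ i ∈ s, 0 < P i := fun i hi => by simpa [hs_def] using hi
  have hsum : ∑ i ∈ s, P i = 1 := by
    rw [← hP1]
    exact Finset.sum_subset (Finset.subset_univ s) fun i _ hi => hsupp i hi
  have hs : s.Nonempty := Finset.nonempty_of_sum_ne_zero (by rw [hsum]; exact one_ne_zero)
  have hcard : (1 : ℝ) ≤ s.card := by exact_mod_cast hs.card_pos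
  by_cases hbdd : BddBelow (Set.range fun σ : Dens d => (1 / (α - 1)) *
    Real.log (∑ i, P i * trR (mpow (W i) α * mpow σ.1 (1 - α))))
  swap
  · rw [renyiInfo, iInf, Real.sInf_of_not_bddBelow hbdd]
    exact Real.log_nonneg hcard
  have hWα : ∀ i, (mpow (W i) α).PosDef := fun i => mpow_posDef (hW i).1 α
  set S := ∑ i ∈ s, P i • mpow (W i) α with hS_def
  have hM : ∀ i ∈ s, (P i • mpow (W i) α).PosDef := fun i hi => (hWα i).smul (hsP i hi)
  have hS : S.PosDef := Matrix.posDef_sum hs hM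
  have hT := mpow_posDef hS (1 / α)
  set t := trR (mpow S (1 / α)) with ht_def
  have ht : 0 < t := trR_pos hT
  have htrace : (mpow S (1 / α)).trace = (t : ℂ) := by
    refine Complex.ext (by simp [ht_def, trR]) ?_
    simpa using (Complex.lt_def.mp hT.trace_pos).2.symm
  have hσ : (t⁻¹ • mpow S (1 / α)).PosDef ∧ (t⁻¹ • mpow S (1 / α)).trace = 1 := by
    refine ⟨hT.smul (inv_pos.mpr ht), ?_⟩
    rw [Matrix.trace_smul, htrace, Complex.real_smul, ← Complex.ofReal_mul,
      inv_mul_cancel₀ ht.ne', Complex.ofReal_one]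
  have hval : ∑ i, P i * trR (mpow (W i) α * mpow (t⁻¹ • mpow S (1 / α)) (1 - α)) = t ^ α := by
    rw [ht_def, ← trR_mul_mpow_normalized hS hα0, ← ht_def]
    conv_rhs => rw [hS_def, Finset.sum_mul, trR_sum]
    simp only [Matrix.smul_mul, trR_smul]
    exact (Finset.sum_subset (Finset.subset_univ s) fun i _ hi => by simp [hsupp i hi]).symm
  have ht_le : t ≤ ∑ i ∈ s, P i ^ (1 / α) := by
    refine (trR_mpow_sum_le hs hM (by positivity) ((div_le_one hα0).mpr hα.le)).trans_eq
      (Finset.sum_congr rfl fun i hi => ?_)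
    rw [mpow_smul (hWα i) (hsP i hi), mpow_mpow (hW i).1 hα0.ne', mul_one_div_cancel hα0.ne',
      mpow_one (hW i).1, trR_smul, trR, (hW i).2, Complex.one_re, mul_one]
  have htα : t ^ α ≤ (s.card : ℝ) ^ (α - 1) := by
    calc t ^ α ≤ (∑ i ∈ s, P i ^ (1 / α)) ^ α := Real.rpow_le_rpow ht.le ht_le hα0.le
      _ ≤ (s.card : ℝ) ^ (α - 1) * ∑ i ∈ s, (P i ^ (1 / α)) ^ α :=
        Real.rpow_sum_le_const_mul_sum_rpow_of_nonneg s hα.le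
          fun i _ => Real.rpow_nonneg (hP i) _
      _ = (s.card : ℝ) ^ (α - 1) := by
        simp only [← Real.rpow_mul (hP _), one_div_mul_cancel hα0.ne', Real.rpow_one, hsum,
          mul_one]
  refine (ciInf_le hbdd ⟨t⁻¹ • mpow S (1 / α), hσ⟩).trans ?_
  have hα1 : 0 < α - 1 := by linarith
  rw [hval, one_div, inv_mul_le_iff₀ hα1, ← Real.log_rpow (by linarith)]
  exact Real.log_le_log (by positivity) htα
end

section
/- (Uniform continuity of the Augustin information in the prior.) Let C := sup over probability vectors Q on {1,…,n} of I^{(2)}_1(Q,W) (this supremum is finite). Then for all probability vectors P_0, P_1 on {1,…,n} and all α ∈ (0,1], setting δ := (1/2)·‖P_0−P_1‖₁, one has |I^{(2)}_α(P_0,W) − I^{(2)}_α(P_1,W)| ≤ h(δ) + δ·C. -/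
open Matrix
open scoped ComplexOrder

/-- Umegaki relative entropy. -/
noncomputable def Dumegaki {d : ℕ} (ρ σ : Matrix (Fin d) (Fin d) ℂ) : ℝ :=
  trR (ρ * (mlog ρ - mlog σ))

/-- Petz Rényi divergence, extended to `α = 1` by the Umegaki relative entropy. -/
noncomputable def DpetzFull {d : ℕ} (α : ℝ) (ρ σ : Matrix (Fin d) (Fin d) ℂ) : ℝ :=
  if α = 1 then Dumegaki ρ σ
  else (1 / (α - 1)) * Real.log (trR (mpow ρ α * mpow σ (1 - α)))

/-- Petz Augustin information. -/
noncomputable def augustinInfo {d n : ℕ} (α : ℝ) (W : Fin n → Matrix (Fin d) (Fin d) ℂ)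
    (P : Fin n → ℝ) : ℝ :=
  ⨅ σ : Dens d, ∑ i, P i * DpetzFull α (W i) σ.1

/-- Binary entropy. -/
noncomputable def bent (δ : ℝ) : ℝ := -δ * Real.log δ - (1 - δ) * Real.log (1 - δ)

/-- Traces of products of functions of two hermitian matrices are weighted sums over pairs of
eigenvalues (the Nussbaum–Szkoła representation). -/
lemma exists_weights_trR_cfc_mul_cfc {ι : Type*} [Fintype ι] [DecidableEq ι]
    {A B : Matrix ι ι ℂ} (hA : A.IsHermitian) (hB : B.IsHermitian) :
    ∃ p : ι × ι → ℝ, (∀ x, 0 ≤ p x) ∧ ∀ f g : ℝ → ℝ,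
      trR (cfc f A * cfc g B) =
        ∑ x, p x * (f (hA.eigenvalues x.1) * g (hB.eigenvalues x.2)) := by
  let U : Matrix ι ι ℂ := hA.eigenvectorUnitary.1
  let V : Matrix ι ι ℂ := hB.eigenvectorUnitary.1
  refine ⟨fun x => Complex.normSq ((star U * V) x.1 x.2), fun x => Complex.normSq_nonneg _, ?_⟩
  intro f g
  rw [hA.cfc_eq, hB.cfc_eq, IsHermitian.cfc, IsHermitian.cfc,
    Unitary.conjStarAlgAut_apply, Unitary.conjStarAlgAut_apply]
  change trR (U * diagonal _ * star U * (V * diagonal _ * star V)) = _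
  have hcyc : (U * diagonal (RCLike.ofReal ∘ f ∘ hA.eigenvalues) * star U *
      (V * diagonal (RCLike.ofReal ∘ g ∘ hB.eigenvalues) * star V)).trace =
      ((diagonal (RCLike.ofReal ∘ f ∘ hA.eigenvalues) * (star U * V)) *
        (diagonal (RCLike.ofReal ∘ g ∘ hB.eigenvalues) * star (star U * V))).trace := by
    rw [star_mul, star_star, Matrix.mul_assoc, Matrix.mul_assoc, Matrix.trace_mul_comm]
    simp only [Matrix.mul_assoc]
  rw [trR, hcyc, Matrix.trace]
  simp only [Matrix.diag_apply, Matrix.mul_apply (M := diagonal _ * _), Matrix.diagonal_mul,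
    Matrix.star_apply, Complex.re_sum, Fintype.sum_prod_type]
  refine Finset.sum_congr rfl fun i _ => Finset.sum_congr rfl fun j _ => ?_
  simp only [Function.comp_apply, RCLike.star_def]
  generalize (star U * V) i j = z
  simp [Complex.normSq_apply]
  ring

/-- Classical (Nussbaum–Szkoła) representation of the divergences of two positive definite
density matrices. -/
lemma exists_classical_representation {d : ℕ} {ρ σ : Matrix (Fin d) (Fin d) ℂ}
    (hρ : ρ.PosDef ∧ ρ.trace = 1) (hσ : σ.PosDef ∧ σ.trace = 1) :
    ∃ p l m : Fin d × Fin d → ℝ, (∀ x, 0 ≤ p x) ∧ (∀ x, 0 < l x) ∧ (∀ x, 0 < m x) ∧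
      ∑ x, p x * l x = 1 ∧ ∑ x, p x * m x = 1 ∧
      Dumegaki ρ σ = ∑ x, p x * (l x * (Real.log (l x) - Real.log (m x))) ∧
      ∀ r s : ℝ, trR (mpow ρ r * mpow σ s) = ∑ x, p x * (l x ^ r * m x ^ s) := by
  have hρ' : IsSelfAdjoint ρ := hρ.1.isHermitian
  have hσ' : IsSelfAdjoint σ := hσ.1.isHermitian
  obtain ⟨p, hp, hf⟩ := exists_weights_trR_cfc_mul_cfc hρ.1.isHermitian hσ.1.isHermitian
  have hcont : ∀ (f : ℝ → ℝ) (A : Matrix (Fin d) (Fin d) ℂ), ContinuousOn f (spectrum ℝ A) :=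
    fun f A => (Matrix.finite_real_spectrum (A := A)).continuousOn f
  refine ⟨p, fun x => hρ.1.isHermitian.eigenvalues x.1, fun x => hσ.1.isHermitian.eigenvalues x.2,
    hp, fun x => hρ.1.eigenvalues_pos _, fun x => hσ.1.eigenvalues_pos _, ?_, ?_, ?_,
    fun r s => hf _ _⟩
  · have h := hf id 1
    rw [cfc_id ℝ ρ, cfc_one ℝ σ, mul_one] at h
    simpa [trR, hρ.2] using h.symm
  · have h := hf 1 id
    rw [cfc_id ℝ σ, cfc_one ℝ ρ, one_mul] at h
    simpa [trR, hσ.2] using h.symm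
  · have h1 := hf (fun x => id x * Real.log x) 1
    have h2 := hf id Real.log
    rw [cfc_one ℝ σ, mul_one, cfc_mul id Real.log ρ (hcont _ _) (hcont _ _), cfc_id ℝ ρ] at h1
    rw [cfc_id ℝ ρ] at h2
    have h3 : Dumegaki ρ σ = trR (ρ * cfc Real.log ρ) - trR (ρ * cfc Real.log σ) := by
      simp [Dumegaki, trR, mlog, Matrix.mul_sub, Matrix.trace_sub]
    rw [h3, h1, h2, ← Finset.sum_sub_distrib]
    refine Finset.sum_congr rfl fun x _ => ?_
    simp
    ring

lemma trR_mpow_mul_mpow_pos {d : ℕ} {ρ σ : Matrix (Fin d) (Fin d) ℂ}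
    (hρ : ρ.PosDef ∧ ρ.trace = 1) (hσ : σ.PosDef ∧ σ.trace = 1) (r s : ℝ) :
    0 < trR (mpow ρ r * mpow σ s) := by
  obtain ⟨p, l, m, hp, hl, hm, hpl, -, -, h⟩ := exists_classical_representation hρ hσ
  rw [h]
  obtain ⟨x, hx, hx'⟩ := Finset.exists_ne_zero_of_sum_ne_zero (hpl.trans_ne one_ne_zero)
  have hpx : 0 < p x := lt_of_le_of_ne (hp x) (fun h0 => hx' (by simp [← h0]))
  refine Finset.sum_pos' (fun y _ => ?_) ⟨x, hx, ?_⟩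
  · have := hp y; have := hl y; have := hm y
    positivity
  · have := hl x; have := hm x
    positivity

lemma DpetzFull_nonneg {d : ℕ} {ρ σ : Matrix (Fin d) (Fin d) ℂ}
    (hρ : ρ.PosDef ∧ ρ.trace = 1) (hσ : σ.PosDef ∧ σ.trace = 1) {α : ℝ}
    (hα : α ∈ Set.Ioc (0 : ℝ) 1) : 0 ≤ DpetzFull α ρ σ := by
  have hpos := trR_mpow_mul_mpow_pos hρ hσ α (1 - α)
  obtain ⟨p, l, m, hp, hl, hm, hpl, hpm, hD, h⟩ := exists_classical_representation hρ hσ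
  unfold DpetzFull
  split_ifs with h1
  · rw [hD]
    have key : ∑ x, (p x * l x - p x * m x) ≤
        ∑ x, p x * (l x * (Real.log (l x) - Real.log (m x))) := by
      refine Finset.sum_le_sum fun x _ => ?_
      rw [← mul_sub]
      refine mul_le_mul_of_nonneg_left ?_ (hp x)
      have := Real.log_le_sub_one_of_pos (div_pos (hm x) (hl x))
      rw [Real.log_div (hm x).ne' (hl x).ne'] at this
      have h2 := mul_le_mul_of_nonneg_left this (hl x).le
      have h3 : l x * (m x / l x - 1) = m x - l x := by
        have := (hl x).ne'
        field_simp
      linarith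
    rw [Finset.sum_sub_distrib, hpl, hpm] at key
    linarith
  · have hα1 : α < 1 := lt_of_le_of_ne hα.2 h1
    have hle : trR (mpow ρ α * mpow σ (1 - α)) ≤ 1 := by
      rw [h]
      calc _ ≤ ∑ x, (α * (p x * l x) + (1 - α) * (p x * m x)) := by
            refine Finset.sum_le_sum fun x _ => ?_
            have := Real.geom_mean_le_arith_mean2_weighted hα.1.le (sub_nonneg.2 hα.2)
              (hl x).le (hm x).le (by ring)
            have := mul_le_mul_of_nonneg_left this (hp x)
            linarith
        _ = 1 := by
            rw [Finset.sum_add_distrib, ← Finset.mul_sum, ← Finset.mul_sum, hpl, hpm]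
            ring
    exact mul_nonneg_of_nonpos_of_nonpos
      (one_div_nonpos.2 (by linarith)) (Real.log_nonpos hpos.le hle)

lemma DpetzFull_le_DpetzFull_one {d : ℕ} {ρ σ : Matrix (Fin d) (Fin d) ℂ}
    (hρ : ρ.PosDef ∧ ρ.trace = 1) (hσ : σ.PosDef ∧ σ.trace = 1) {α : ℝ}
    (hα : α ∈ Set.Ioc (0 : ℝ) 1) : DpetzFull α ρ σ ≤ DpetzFull 1 ρ σ := by
  rcases hα.2.eq_or_lt with rfl | hα1
  · rfl
  obtain ⟨p, l, m, hp, hl, hm, hpl, hpm, hD, h⟩ := exists_classical_representation hρ hσ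
  rw [DpetzFull, if_neg hα1.ne, DpetzFull, if_pos rfl, hD, h]
  have key := strictConcaveOn_log_Ioi.concaveOn.le_map_sum (t := Finset.univ)
    (w := fun x => p x * l x) (p := fun x => (m x / l x) ^ (1 - α))
    (fun x _ => mul_nonneg (hp x) (hl x).le) hpl
    (fun x _ => Real.rpow_pos_of_pos (div_pos (hm x) (hl x)) _)
  have e1 : ∑ x, (p x * l x) • (m x / l x) ^ (1 - α) = ∑ x, p x * (l x ^ α * m x ^ (1 - α)) := by
    refine Finset.sum_congr rfl fun x _ => ?_
    rw [smul_eq_mul, Real.div_rpow (hm x).le (hl x).le, mul_assoc]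
    have : l x ^ α * l x ^ (1 - α) = l x := by
      rw [← Real.rpow_add (hl x)]
      simp
    have h0 := (Real.rpow_pos_of_pos (hl x) (1 - α)).ne'
    congr 1
    rw [mul_div_assoc', div_eq_iff h0]
    nth_rw 1 [← this]
    ring
  have e2 : ∑ x, (p x * l x) • Real.log ((m x / l x) ^ (1 - α)) =
      (α - 1) * ∑ x, p x * (l x * (Real.log (l x) - Real.log (m x))) := by
    rw [Finset.mul_sum]
    refine Finset.sum_congr rfl fun x _ => ?_
    rw [smul_eq_mul, Real.log_rpow (div_pos (hm x) (hl x)),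
      Real.log_div (hm x).ne' (hl x).ne']
    ring
  rw [e1, e2] at key
  rw [one_div, inv_mul_eq_div, div_le_iff_of_neg (by linarith), mul_comm]
  exact key

section OperatorMonotonicity

open scoped MatrixOrder Matrix.Norms.L2Operator

lemma trR_mul_le_trR_mul_s10 {ι : Type*} [Fintype ι] [DecidableEq ι] {X A B : Matrix ι ι ℂ}
    (hX : X.PosSemidef) (hAB : A ≤ B) : trR (X * A) ≤ trR (X * B) := by
  obtain ⟨Y, rfl⟩ := CStarAlgebra.nonneg_iff_eq_star_mul_self.1 (Matrix.nonneg_iff_posSemidef.2 hX)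
  have h := ((Matrix.le_iff.1 hAB).mul_mul_conjTranspose_same Y).trace_nonneg
  rw [Matrix.mul_assoc, Matrix.trace_mul_comm, Matrix.mul_assoc, Matrix.trace_mul_comm,
    Matrix.mul_sub, Matrix.trace_sub] at h
  simpa [trR, star_eq_conjTranspose] using (Complex.le_def.1 h).1

/-- Subnormalised antitonicity of the Petz divergence in its second argument. -/
lemma DpetzFull_le_sub_log_of_smul_le {d : ℕ} {ρ σ τ : Matrix (Fin d) (Fin d) ℂ}
    (hρ : ρ.PosDef ∧ ρ.trace = 1) (hσ : σ.PosDef ∧ σ.trace = 1) (hτ : τ.PosDef ∧ τ.trace = 1)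
    {α c : ℝ} (hα : α ∈ Set.Ioc (0 : ℝ) 1) (hc : 0 < c) (h : c • σ ≤ τ) :
    DpetzFull α ρ τ ≤ DpetzFull α ρ σ - Real.log c := by
  have hcσ : (c • σ).PosDef := hσ.1.smul hc
  have hσ' : IsSelfAdjoint σ := hσ.1.isHermitian
  have hcont : ∀ f : ℝ → ℝ, ContinuousOn f ((c • ·) '' spectrum ℝ σ) :=
    fun f => ((Matrix.finite_real_spectrum (A := σ)).image _).continuousOn f
  have hcont' : ∀ f : ℝ → ℝ, ContinuousOn f (spectrum ℝ σ) :=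
    fun f => (Matrix.finite_real_spectrum (A := σ)).continuousOn f
  have hspec : ∀ x ∈ spectrum ℝ σ, 0 < x := by
    intro x hx
    rw [hσ.1.isHermitian.spectrum_real_eq_range_eigenvalues] at hx
    obtain ⟨i, rfl⟩ := hx
    exact hσ.1.eigenvalues_pos i
  rcases eq_or_ne α 1 with rfl | hα1
  · have hlog : mlog (c • σ) = Real.log c • (1 : Matrix (Fin d) (Fin d) ℂ) + mlog σ := by
      rw [mlog, mlog, ← cfc_comp_smul c Real.log σ (hcont _),
        cfc_congr (g := fun x => Real.log c + Real.log x)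
          (fun x hx => by simpa using Real.log_mul hc.ne' (hspec x hx).ne'),
        cfc_const_add _ _ _ (hcont' _), Algebra.algebraMap_eq_smul_one]
    have hle : mlog (c • σ) ≤ mlog τ :=
      CFC.log_le_log h (Matrix.isStrictlyPositive_iff_posDef.2 hcσ)
    have := trR_mul_le_trR_mul_s10 hρ.1.posSemidef hle
    rw [hlog] at this
    simp only [DpetzFull, if_pos, Dumegaki, trR, Matrix.mul_sub, Matrix.mul_add, Matrix.trace_sub,
      Matrix.trace_add, Matrix.mul_smul, Matrix.trace_smul, Matrix.mul_one, hρ.2,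
      Complex.add_re, Complex.sub_re, Complex.smul_re, Complex.one_re, smul_eq_mul] at this ⊢
    linarith
  · have hα' : α < 1 := lt_of_le_of_ne hα.2 hα1
    have hpow : mpow (c • σ) (1 - α) = c ^ (1 - α) • mpow σ (1 - α) := by
      rw [mpow, mpow, ← cfc_comp_smul c (fun x : ℝ => x ^ (1 - α)) σ (hcont _),
        cfc_congr (g := fun x => c ^ (1 - α) • x ^ (1 - α))
          (fun x hx => by simpa using Real.mul_rpow hc.le (hspec x hx).le),
        cfc_smul _ _ _ (hcont' _)]
    have hle : mpow (c • σ) (1 - α) ≤ mpow τ (1 - α) := by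
      have := CFC.rpow_le_rpow (p := 1 - α) ⟨by linarith, by linarith [hα.1]⟩ h
      rwa [CFC.rpow_eq_cfc_real (Matrix.nonneg_iff_posSemidef.2 hcσ.posSemidef),
        CFC.rpow_eq_cfc_real (Matrix.nonneg_iff_posSemidef.2 hτ.1.posSemidef)] at this
    have hX : (mpow ρ α).PosSemidef := by
      refine Matrix.nonneg_iff_posSemidef.1 (cfc_nonneg fun x hx => Real.rpow_nonneg ?_ _)
      rw [hρ.1.isHermitian.spectrum_real_eq_range_eigenvalues] at hx
      obtain ⟨i, rfl⟩ := hx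
      exact (hρ.1.eigenvalues_pos i).le
    have htr := trR_mul_le_trR_mul_s10 hX hle
    have hcpos := Real.rpow_pos_of_pos hc (1 - α)
    have hpos := trR_mpow_mul_mpow_pos hρ hσ α (1 - α)
    have htr' : c ^ (1 - α) * trR (mpow ρ α * mpow σ (1 - α)) ≤
        trR (mpow ρ α * mpow τ (1 - α)) := by
      rw [hpow] at htr
      simpa [trR, Matrix.mul_smul, Matrix.trace_smul] using htr
    have hl := Real.log_le_log (mul_pos hcpos hpos) htr'
    rw [Real.log_mul hcpos.ne' hpos.ne', Real.log_rpow hc] at hl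
    rw [DpetzFull, if_neg hα1, DpetzFull, if_neg hα1, one_div, inv_mul_eq_div,
      inv_mul_eq_div, div_le_iff_of_neg (by linarith), sub_mul, div_mul_cancel₀ _ (by linarith)]
    linarith

lemma smul_le_add_smul {ι : Type*} [Fintype ι] [DecidableEq ι] {σ τ : Matrix ι ι ℂ} {a b : ℝ}
    (hτ : τ.PosDef) (hb : 0 < b) : a • σ ≤ a • σ + b • τ := by
  rw [Matrix.le_iff, add_sub_cancel_left]
  exact (hτ.smul hb).posSemidef

/-- Mixing two states costs at most `-log` of the respective weight in the Petz divergence. -/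
lemma exists_DpetzFull_le_sub_log {d : ℕ} (σ τ : Dens d) {δ : ℝ} (h0 : 0 < δ) (h1 : δ < 1) :
    ∃ ω : Dens d, ∀ ρ : Matrix (Fin d) (Fin d) ℂ, ρ.PosDef ∧ ρ.trace = 1 →
      ∀ α ∈ Set.Ioc (0 : ℝ) 1,
        DpetzFull α ρ ω.1 ≤ DpetzFull α ρ σ.1 - Real.log (1 - δ) ∧
        DpetzFull α ρ ω.1 ≤ DpetzFull α ρ τ.1 - Real.log δ := by
  have h1' : 0 < 1 - δ := sub_pos.2 h1
  have hω : ((1 - δ) • σ.1 + δ • τ.1).PosDef ∧ ((1 - δ) • σ.1 + δ • τ.1).trace = 1 := by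
    refine ⟨(σ.2.1.smul h1').add (τ.2.1.smul h0), ?_⟩
    rw [Matrix.trace_add, Matrix.trace_smul, Matrix.trace_smul, σ.2.2, τ.2.2, ← add_smul]
    simp
  refine ⟨⟨_, hω⟩, fun ρ hρ α hα => ⟨?_, ?_⟩⟩
  · exact DpetzFull_le_sub_log_of_smul_le hρ σ.2 hω hα h1' (smul_le_add_smul τ.2.1 h0)
  · refine DpetzFull_le_sub_log_of_smul_le hρ τ.2 hω hα h0 ?_
    rw [add_comm]
    exact smul_le_add_smul σ.2.1 h1'

end OperatorMonotonicity

lemma sum_mul_DpetzFull_nonneg {d n : ℕ} {W : Fin n → Matrix (Fin d) (Fin d) ℂ}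
    (hW : ∀ i, (W i).PosDef ∧ (W i).trace = 1) {P : Fin n → ℝ} (hP : ∀ i, 0 ≤ P i) {α : ℝ}
    (hα : α ∈ Set.Ioc (0 : ℝ) 1) (σ : Dens d) : 0 ≤ ∑ i, P i * DpetzFull α (W i) σ.1 :=
  Finset.sum_nonneg fun i _ => mul_nonneg (hP i) (DpetzFull_nonneg (hW i) σ.2 hα)

lemma augustinInfo_nonneg {d n : ℕ} {W : Fin n → Matrix (Fin d) (Fin d) ℂ}
    (hW : ∀ i, (W i).PosDef ∧ (W i).trace = 1) {P : Fin n → ℝ} (hP : ∀ i, 0 ≤ P i) {α : ℝ}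
    (hα : α ∈ Set.Ioc (0 : ℝ) 1) : 0 ≤ augustinInfo α W P :=
  Real.iInf_nonneg fun σ => sum_mul_DpetzFull_nonneg hW hP hα σ

lemma augustinInfo_le {d n : ℕ} {W : Fin n → Matrix (Fin d) (Fin d) ℂ}
    (hW : ∀ i, (W i).PosDef ∧ (W i).trace = 1) {P : Fin n → ℝ} (hP : ∀ i, 0 ≤ P i) {α : ℝ}
    (hα : α ∈ Set.Ioc (0 : ℝ) 1) (σ : Dens d) :
    augustinInfo α W P ≤ ∑ i, P i * DpetzFull α (W i) σ.1 :=
  ciInf_le ⟨0, by rintro _ ⟨τ, rfl⟩; exact sum_mul_DpetzFull_nonneg hW hP hα τ⟩ σ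

lemma sum_mul_DpetzFull_le_one {d n : ℕ} {W : Fin n → Matrix (Fin d) (Fin d) ℂ}
    (hW : ∀ i, (W i).PosDef ∧ (W i).trace = 1) {P : Fin n → ℝ} (hP : ∀ i, 0 ≤ P i) {α : ℝ}
    (hα : α ∈ Set.Ioc (0 : ℝ) 1) (σ : Dens d) :
    ∑ i, P i * DpetzFull α (W i) σ.1 ≤ ∑ i, P i * DpetzFull 1 (W i) σ.1 :=
  Finset.sum_le_sum fun i _ =>
    mul_le_mul_of_nonneg_left (DpetzFull_le_DpetzFull_one (hW i) σ.2 hα) (hP i)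

lemma bddAbove_augustinInfo_one {d n : ℕ} [Nonempty (Dens d)]
    {W : Fin n → Matrix (Fin d) (Fin d) ℂ} (hW : ∀ i, (W i).PosDef ∧ (W i).trace = 1) :
    BddAbove (Set.range fun Q : {Q : Fin n → ℝ // (∀ i, 0 ≤ Q i) ∧ ∑ i, Q i = 1} =>
      augustinInfo 1 W Q.1) := by
  have σ : Dens d := Classical.arbitrary _
  refine ⟨∑ i, DpetzFull 1 (W i) σ.1, ?_⟩
  rintro _ ⟨Q, rfl⟩
  refine (augustinInfo_le hW Q.2.1 ⟨one_pos, le_rfl⟩ σ).trans (Finset.sum_le_sum fun i _ => ?_)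
  refine mul_le_of_le_one_left (DpetzFull_nonneg (hW i) σ.2 ⟨one_pos, le_rfl⟩) ?_
  exact (Finset.single_le_sum (fun j _ => Q.2.1 j) (Finset.mem_univ i)).trans_eq Q.2.2

/-- One-sided continuity estimate: `δ` is the mass of `P₁` in excess of `P₀`. -/
lemma augustinInfo_le_add_bent {d n : ℕ} [Nonempty (Dens d)]
    {W : Fin n → Matrix (Fin d) (Fin d) ℂ} (hW : ∀ i, (W i).PosDef ∧ (W i).trace = 1) {C : ℝ}
    (hC : ∀ Q : Fin n → ℝ, (∀ i, 0 ≤ Q i) → ∑ i, Q i = 1 → augustinInfo 1 W Q ≤ C)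
    {P₀ P₁ : Fin n → ℝ} (h₀ : ∀ i, 0 ≤ P₀ i) (h₀' : ∑ i, P₀ i = 1)
    (h₁ : ∀ i, 0 ≤ P₁ i) (h₁' : ∑ i, P₁ i = 1) {α : ℝ} (hα : α ∈ Set.Ioc (0 : ℝ) 1) {δ : ℝ}
    (hδ : δ = (1 / 2) * ∑ i, |P₀ i - P₁ i|) :
    augustinInfo α W P₁ ≤ augustinInfo α W P₀ + (bent δ + δ * C) := by
  have hmin : ∑ i, min (P₀ i) (P₁ i) = 1 - δ := by
    have : ∀ i, min (P₀ i) (P₁ i) = (P₀ i + P₁ i - |P₀ i - P₁ i|) / 2 := fun i => by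
      linarith [min_add_max (P₀ i) (P₁ i), max_sub_min_eq_abs' (P₀ i) (P₁ i)]
    simp_rw [this]
    rw [← Finset.sum_div, Finset.sum_sub_distrib, Finset.sum_add_distrib, h₀', h₁', hδ]
    ring
  set R : Fin n → ℝ := fun i => P₁ i - min (P₀ i) (P₁ i) with hR
  have hRnn : ∀ i, 0 ≤ R i := fun i => sub_nonneg.2 (min_le_right _ _)
  have hRsum : ∑ i, R i = δ := by
    rw [hR, Finset.sum_sub_distrib, hmin, h₁']
    ring
  have hMnn : ∀ i, 0 ≤ min (P₀ i) (P₁ i) := fun i => le_min (h₀ i) (h₁ i)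
  have hδ0 : 0 ≤ δ := hRsum ▸ Finset.sum_nonneg fun i _ => hRnn i
  have hδ1 : δ ≤ 1 := by
    have := Finset.sum_nonneg fun i (_ : i ∈ Finset.univ) => hMnn i
    linarith
  rcases hδ0.eq_or_lt with hδz | hδpos
  · have hP : P₀ = P₁ := by
      funext i
      have hz : ∑ i, |P₀ i - P₁ i| = 0 := by linarith
      have := (Finset.sum_eq_zero_iff_of_nonneg fun i _ => abs_nonneg _).1 hz i
        (Finset.mem_univ i)
      exact sub_eq_zero.1 (abs_eq_zero.1 this)
    rw [hP, ← hδz]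
    simp [bent]
  rcases hδ1.eq_or_lt with rfl | hδlt
  · have hle : augustinInfo α W P₁ ≤ augustinInfo 1 W P₁ :=
      le_ciInf fun σ =>
        (augustinInfo_le hW h₁ hα σ).trans (sum_mul_DpetzFull_le_one hW h₁ hα σ)
    have := hC P₁ h₁ h₁'
    have := augustinInfo_nonneg hW h₀ hα
    simp only [bent, Real.log_one, sub_self, zero_mul, mul_zero, one_mul, zero_add]
    linarith
  have hexcess : δ * augustinInfo 1 W (fun i => R i / δ) ≤ δ * C :=
    mul_le_mul_of_nonneg_left
      (hC _ (fun i => div_nonneg (hRnn i) hδ0)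
        (by rw [← Finset.sum_div, hRsum, div_self hδpos.ne'])) hδ0
  have hmix : ∀ σ τ : Dens d, augustinInfo α W P₁ ≤
      ∑ i, P₀ i * DpetzFull α (W i) σ.1 + bent δ + ∑ i, R i * DpetzFull 1 (W i) τ.1 := by
    intro σ τ
    obtain ⟨ω, hω⟩ := exists_DpetzFull_le_sub_log σ τ hδpos hδlt
    calc augustinInfo α W P₁ ≤ ∑ i, P₁ i * DpetzFull α (W i) ω.1 := augustinInfo_le hW h₁ hα ω
      _ ≤ ∑ i, (P₀ i * DpetzFull α (W i) σ.1 - Real.log (1 - δ) * min (P₀ i) (P₁ i) +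
            (R i * DpetzFull 1 (W i) τ.1 - Real.log δ * R i)) := by
          refine Finset.sum_le_sum fun i _ => ?_
          obtain ⟨hσ, hτ⟩ := hω (W i) (hW i) α hα
          have e1 := mul_le_mul_of_nonneg_left hσ (hMnn i)
          have e2 := mul_le_mul_of_nonneg_left
            (hτ.trans (sub_le_sub_right (DpetzFull_le_DpetzFull_one (hW i) τ.2 hα) _)) (hRnn i)
          have e3 := mul_le_mul_of_nonneg_right (min_le_left (P₀ i) (P₁ i))
            (DpetzFull_nonneg (hW i) σ.2 hα)
          have e4 : P₁ i * DpetzFull α (W i) ω.1 =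
              min (P₀ i) (P₁ i) * DpetzFull α (W i) ω.1 + R i * DpetzFull α (W i) ω.1 := by
            simp only [hR]
            ring
          linarith
      _ = _ := by
          rw [Finset.sum_add_distrib, Finset.sum_sub_distrib, Finset.sum_sub_distrib,
            ← Finset.mul_sum, ← Finset.mul_sum, hmin, hRsum, bent]
          ring
  have hτ : ∀ σ : Dens d, augustinInfo α W P₁ - bent δ - ∑ i, P₀ i * DpetzFull α (W i) σ.1 ≤
      δ * augustinInfo 1 W (fun i => R i / δ) := by
    intro σ
    rw [augustinInfo, augustinInfo, Real.mul_iInf_of_nonneg hδ0]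
    refine le_ciInf fun τ => ?_
    have e : δ * ∑ i, R i / δ * DpetzFull 1 (W i) τ.1 = ∑ i, R i * DpetzFull 1 (W i) τ.1 := by
      rw [Finset.mul_sum]
      refine Finset.sum_congr rfl fun i _ => ?_
      field_simp
    rw [e]
    have := hmix σ τ
    rw [augustinInfo] at this
    linarith
  have hσ : augustinInfo α W P₁ - bent δ - δ * C ≤ augustinInfo α W P₀ :=
    le_ciInf fun σ => by linarith [hτ σ]
  linarith

lemma nonempty_dens {d : ℕ} (hd : 0 < d) : Nonempty (Dens d) := by
  have hd' : (0 : ℝ) < d := by exact_mod_cast hd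
  refine ⟨⟨(d : ℝ)⁻¹ • 1, Matrix.PosDef.one.smul (inv_pos.2 hd'), ?_⟩⟩
  have : (d : ℂ) ≠ 0 := by exact_mod_cast hd.ne'
  simp [Matrix.trace_smul, this]

/-- uniform continuity of the Augustin information in the prior. -/
theorem augustinInfo_uniform_continuity_in_prior {d n : ℕ} (hd : 0 < d) (hn : 0 < n)
    (W : Fin n → Matrix (Fin d) (Fin d) ℂ)
    (hW : ∀ i, (W i).PosDef ∧ (W i).trace = 1)
    (C : ℝ)
    (hC : C = ⨆ Q : {Q : Fin n → ℝ // (∀ i, 0 ≤ Q i) ∧ ∑ i, Q i = 1},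
      augustinInfo 1 W Q.1) :
    BddAbove (Set.range fun Q : {Q : Fin n → ℝ // (∀ i, 0 ≤ Q i) ∧ ∑ i, Q i = 1} =>
      augustinInfo 1 W Q.1) ∧
    ∀ P₀ P₁ : Fin n → ℝ,
      (∀ i, 0 ≤ P₀ i) → ∑ i, P₀ i = 1 →
      (∀ i, 0 ≤ P₁ i) → ∑ i, P₁ i = 1 →
      ∀ α ∈ Set.Ioc (0 : ℝ) 1,
        ∀ δ : ℝ, δ = (1 / 2) * ∑ i, |P₀ i - P₁ i| →
          |augustinInfo α W P₀ - augustinInfo α W P₁| ≤ bent δ + δ * C := by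
  have := nonempty_dens hd
  have hbdd := bddAbove_augustinInfo_one hW
  refine ⟨hbdd, fun P₀ P₁ h₀ h₀' h₁ h₁' α hα δ hδ => ?_⟩
  have hC' : ∀ Q : Fin n → ℝ, (∀ i, 0 ≤ Q i) → ∑ i, Q i = 1 → augustinInfo 1 W Q ≤ C :=
    fun Q hQ hQ' => hC ▸ le_ciSup hbdd ⟨Q, hQ, hQ'⟩
  have hδ' : δ = (1 / 2) * ∑ i, |P₁ i - P₀ i| := by simp_rw [hδ, abs_sub_comm]
  rw [abs_sub_le_iff]
  constructor
  · linarith [augustinInfo_le_add_bent hW hC' h₁ h₁' h₀ h₀' hα hδ']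
  · linarith [augustinInfo_le_add_bent hW hC' h₀ h₀' h₁ h₁' hα hδ]
end
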